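/- arXiv:2408.13103 — 5 statements merged into one kernel-verified Lean document; each statement's English description precedes it below -/
import Mathlib

section
/- The function Ψ attains a strict global minimum on (0,∞) at φ_min: for every real φ > 0 with φ ≠ φ_min one has Ψ(φ_min) < Ψ(φ), and φ_min > 0. -/
/-- If `m ^ 2 + a * m = a * β`, then `m` is a double root of `Ψ φ - Ψ m`, where
`Ψ φ = (β + φ) ^ 2 / (a * β) * (1 / φ + 1 / (2 * a))`. -/
theorem sub_eq_of_sq_add_mul_eq {a β m x : ℝ} (ha : a ≠ 0) (hβ : β ≠ 0) (hm : m ≠ 0)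
    (hx : x ≠ 0) (h : m ^ 2 + a * m = a * β) :
    (β + x) ^ 2 / (a * β) * (1 / x + 1 / (2 * a)) - (β + m) ^ 2 / (a * β) * (1 / m + 1 / (2 * a)) =
      (x - m) ^ 2 * (x * m ^ 2 + 2 * a * β ^ 2) / (2 * a ^ 2 * β * x * m ^ 2) := by
  field_simp
  linear_combination (2 * x * (x - m) * (m + β)) * h

/-- The function `Ψ` attains a strict global minimum on `(0,∞)` at `φ_min`:
`φ_min > 0` and for every `φ > 0` with `φ ≠ φ_min`, `Ψ φ_min < Ψ φ`. -/
theorem stmt_0 (β γ₀ Λ : ℝ) (hβ : 0 < β) (hγ : 0 < γ₀) (hΛ : 0 < Λ) :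
    let Ψ : ℝ → ℝ := fun φ => ((β + φ) ^ 2 / (γ₀ * Λ * β)) * (1 / φ + 1 / (2 * γ₀ * Λ))
    let φmin : ℝ := (γ₀ * Λ / 2) * (Real.sqrt (1 + 4 * β / (γ₀ * Λ)) - 1)
    0 < φmin ∧ ∀ φ : ℝ, 0 < φ → φ ≠ φmin → Ψ φmin < Ψ φ := by
  intro Ψ φmin
  have ha : 0 < γ₀ * Λ := mul_pos hγ hΛ
  have hq : 0 < 4 * β / (γ₀ * Λ) := by positivity
  have hs : 1 < Real.sqrt (1 + 4 * β / (γ₀ * Λ)) := by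
    rw [Real.lt_sqrt zero_le_one]
    linarith
  have hm : 0 < φmin := mul_pos (half_pos ha) (sub_pos.2 hs)
  have h : φmin ^ 2 + γ₀ * Λ * φmin = γ₀ * Λ * β := by
    have hsq := Real.sq_sqrt (add_pos one_pos hq).le
    have hc : γ₀ * Λ * (4 * β / (γ₀ * Λ)) = 4 * β := mul_div_cancel₀ _ ha.ne'
    simp only [φmin]
    linear_combination (γ₀ * Λ) ^ 2 / 4 * hsq + γ₀ * Λ / 4 * hc
  refine ⟨hm, fun φ hφ hne => sub_pos.1 ?_⟩
  simp only [Ψ, mul_assoc 2 γ₀ Λ]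
  rw [sub_eq_of_sq_add_mul_eq ha.ne' hβ.ne' hm.ne' hφ.ne' h]
  have hd : 0 < (φ - φmin) ^ 2 := sq_pos_of_ne_zero (sub_ne_zero.2 hne)
  positivity
end

section
/- For every real φ > 0, the derivative of Ψ at φ equals (1/(γ₀Λβ))·(1 − β²/φ² + (β+φ)/(γ₀Λ)), and this derivative vanishes at a point φ > 0 if and only if φ = φ_min. -/
theorem quadratic_eq_zero_iff_eq_pos_root {g β φ : ℝ} (hg : 0 < g) (hβ : 0 < β) (hφ : 0 < φ) :
    φ ^ 2 + g * φ - g * β = 0 ↔ φ = g / 2 * (√(1 + 4 * β / g) - 1) := by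
  have hroot : φ = g / 2 * (√(1 + 4 * β / g) - 1) ↔ √(1 + 4 * β / g) = 2 * φ / g + 1 := by
    generalize √(1 + 4 * β / g) = s
    constructor
    · intro h
      field_simp
      linarith
    · intro h
      rw [h]
      field_simp
      ring
  have hsq : (2 * φ / g + 1) ^ 2 - (1 + 4 * β / g) = 4 / g ^ 2 * (φ ^ 2 + g * φ - g * β) := by
    field_simp
    ring
  rw [hroot, Real.sqrt_eq_iff_eq_sq (by positivity) (by positivity), eq_comm (a := 1 + _),
    ← sub_eq_zero (a := _ ^ 2), hsq, mul_eq_zero, or_iff_right (by positivity)]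

/-- For every `φ > 0`, the derivative of `Ψ` at `φ` equals
`(1/(γ₀Λβ))·(1 − β²/φ² + (β+φ)/(γ₀Λ))`, and this derivative vanishes at a point `φ > 0`
iff `φ = φ_min`. -/
theorem stmt_1 (β γ₀ Λ : ℝ) (hβ : 0 < β) (hγ : 0 < γ₀) (hΛ : 0 < Λ) :
    let Ψ : ℝ → ℝ := fun φ => ((β + φ) ^ 2 / (γ₀ * Λ * β)) * (1 / φ + 1 / (2 * γ₀ * Λ))
    let φmin : ℝ := (γ₀ * Λ / 2) * (Real.sqrt (1 + 4 * β / (γ₀ * Λ)) - 1)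
    ∀ φ : ℝ, 0 < φ →
      HasDerivAt Ψ ((1 / (γ₀ * Λ * β)) * (1 - β ^ 2 / φ ^ 2 + (β + φ) / (γ₀ * Λ))) φ ∧
      ((1 / (γ₀ * Λ * β)) * (1 - β ^ 2 / φ ^ 2 + (β + φ) / (γ₀ * Λ)) = 0 ↔ φ = φmin) := by
  intro Ψ φmin φ hφ
  have hg : 0 < γ₀ * Λ := mul_pos hγ hΛ
  refine ⟨?_, ?_⟩
  · have hsq : HasDerivAt (fun x : ℝ => (β + x) ^ 2 / (γ₀ * Λ * β))
        (2 * (β + φ) / (γ₀ * Λ * β)) φ := by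
      simpa using (((hasDerivAt_id φ).const_add β).pow 2).div_const (γ₀ * Λ * β)
    have hinv : HasDerivAt (fun x : ℝ => 1 / x + 1 / (2 * γ₀ * Λ)) (-(φ ^ 2)⁻¹) φ := by
      simpa using (hasDerivAt_inv hφ.ne').add_const (1 / (2 * γ₀ * Λ))
    refine (hsq.mul hinv).congr_deriv ?_
    field_simp
    ring
  · have hfactor : 1 / (γ₀ * Λ * β) * (1 - β ^ 2 / φ ^ 2 + (β + φ) / (γ₀ * Λ)) =
        (β + φ) / ((γ₀ * Λ) ^ 2 * β * φ ^ 2) * (φ ^ 2 + γ₀ * Λ * φ - γ₀ * Λ * β) := by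
      field_simp
      ring
    rw [hfactor, mul_eq_zero, or_iff_right (by positivity)]
    exact quadratic_eq_zero_iff_eq_pos_root hg hβ hφ
end

section
/- For every real φ > 0, the second derivative of Ψ at φ equals 2β/(γ₀Λφ³) + 1/(βγ₀²Λ²); in particular the second derivative of Ψ is strictly positive everywhere on (0,∞), so Ψ is strictly convex on (0,∞) and the critical point φ_min is a minimum. -/
theorem hasDerivAt_sq_mul_inv_add (β g φ : ℝ) (hβ : 0 < β) (hg : 0 < g) (hφ : 0 < φ) :
    HasDerivAt (fun x : ℝ => ((β + x) ^ 2 / (g * β)) * (1 / x + 1 / (2 * g)))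
      ((1 + (β + φ) / g - β ^ 2 / φ ^ 2) / (g * β)) φ := by
  have hsq := (((hasDerivAt_id φ).const_add β).pow 2).div_const (g * β)
  have hinv := ((hasDerivAt_inv hφ.ne').add_const (1 / (2 * g)))
  have h := hsq.mul hinv
  simp only [one_div] at h ⊢
  refine h.congr_deriv ?_
  simp
  field_simp
  ring

theorem hasDerivAt_one_add_sub_inv_sq (β g φ : ℝ) (hβ : 0 < β) (hg : 0 < g) (hφ : 0 < φ) :
    HasDerivAt (fun x : ℝ => (1 + (β + x) / g - β ^ 2 / x ^ 2) / (g * β))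
      (2 * β / (g * φ ^ 3) + 1 / (β * g ^ 2)) φ := by
  have hlin := (((hasDerivAt_id φ).const_add β).div_const g).const_add 1
  have hinv := (hasDerivAt_const φ (β ^ 2)).div ((hasDerivAt_id φ).pow 2) (by simp [hφ.ne'])
  refine ((hlin.sub hinv).div_const (g * β)).congr_deriv ?_
  simp
  field_simp
  ring

theorem sq_mul_inv_add_le_of_root (β g m φ : ℝ) (hβ : 0 < β) (hg : 0 < g) (hm : 0 < m)
    (hφ : 0 < φ) (hroot : m ^ 2 + g * m = g * β) :
    ((β + m) ^ 2 / (g * β)) * (1 / m + 1 / (2 * g)) ≤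
      ((β + φ) ^ 2 / (g * β)) * (1 / φ + 1 / (2 * g)) := by
  have key : ((β + φ) ^ 2 / (g * β)) * (1 / φ + 1 / (2 * g)) -
      ((β + m) ^ 2 / (g * β)) * (1 / m + 1 / (2 * g)) =
      (φ - m) ^ 2 / (g * β) * (β ^ 2 / (φ * m ^ 2) + 1 / (2 * g)) := by
    have hβ' : β = m * (m + g) / g := by
      field_simp
      linarith
    have hmg : m + g ≠ 0 := by positivity
    subst hβ'
    field_simp
    ring
  have : 0 ≤ (φ - m) ^ 2 / (g * β) * (β ^ 2 / (φ * m ^ 2) + 1 / (2 * g)) := by positivity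
  linarith

/-- For every `φ > 0`, the second derivative of `Ψ` at `φ` equals
`2β/(γ₀Λφ³) + 1/(βγ₀²Λ²)`, which is strictly positive; hence `Ψ` is strictly convex on
`(0,∞)` and the critical point `φ_min` is a minimum. -/
theorem stmt_2 (β γ₀ Λ : ℝ) (hβ : 0 < β) (hγ : 0 < γ₀) (hΛ : 0 < Λ) :
    let Ψ : ℝ → ℝ := fun φ => ((β + φ) ^ 2 / (γ₀ * Λ * β)) * (1 / φ + 1 / (2 * γ₀ * Λ))
    let φmin : ℝ := (γ₀ * Λ / 2) * (Real.sqrt (1 + 4 * β / (γ₀ * Λ)) - 1)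
    (∀ φ : ℝ, 0 < φ →
      deriv (deriv Ψ) φ = 2 * β / (γ₀ * Λ * φ ^ 3) + 1 / (β * γ₀ ^ 2 * Λ ^ 2) ∧
      0 < deriv (deriv Ψ) φ) ∧
    StrictConvexOn ℝ (Set.Ioi 0) Ψ ∧
    (∀ φ ∈ Set.Ioi (0 : ℝ), Ψ φmin ≤ Ψ φ) := by
  intro Ψ φmin
  have hg : 0 < γ₀ * Λ := mul_pos hγ hΛ
  have hΨ : Ψ = fun x => ((β + x) ^ 2 / (γ₀ * Λ * β)) * (1 / x + 1 / (2 * (γ₀ * Λ))) := by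
    funext x
    simp only [Ψ, mul_assoc]
  have hderiv : ∀ φ : ℝ, 0 < φ → HasDerivAt Ψ
      ((1 + (β + φ) / (γ₀ * Λ) - β ^ 2 / φ ^ 2) / (γ₀ * Λ * β)) φ := fun φ hφ =>
    hΨ ▸ hasDerivAt_sq_mul_inv_add β (γ₀ * Λ) φ hβ hg hφ
  have hderiv2 : ∀ φ : ℝ, 0 < φ →
      deriv (deriv Ψ) φ = 2 * β / (γ₀ * Λ * φ ^ 3) + 1 / (β * γ₀ ^ 2 * Λ ^ 2) := by
    intro φ hφ
    have heq : deriv Ψ =ᶠ[nhds φ]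
        fun x => (1 + (β + x) / (γ₀ * Λ) - β ^ 2 / x ^ 2) / (γ₀ * Λ * β) := by
      filter_upwards [Ioi_mem_nhds hφ] with x hx using (hderiv x hx).deriv
    rw [heq.deriv_eq, (hasDerivAt_one_add_sub_inv_sq β (γ₀ * Λ) φ hβ hg hφ).deriv, mul_pow,
      mul_assoc β]
  have hpos : ∀ φ : ℝ, 0 < φ → 0 < deriv (deriv Ψ) φ := by
    intro φ hφ
    rw [hderiv2 φ hφ]
    positivity
  refine ⟨fun φ hφ => ⟨hderiv2 φ hφ, hpos φ hφ⟩, ?_, fun φ hφ => ?_⟩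
  · exact strictConvexOn_of_deriv2_pos' (convex_Ioi 0)
      (fun x hx => (hderiv x hx).continuousAt.continuousWithinAt) hpos
  · have hsqrt : 1 < Real.sqrt (1 + 4 * β / (γ₀ * Λ)) := by
      rw [Real.lt_sqrt zero_le_one, one_pow]
      exact lt_add_of_pos_right 1 (by positivity)
    have hmin : 0 < φmin := mul_pos (by positivity) (sub_pos.2 hsqrt)
    have hroot : φmin ^ 2 + γ₀ * Λ * φmin = γ₀ * Λ * β := by
      have hsq : Real.sqrt (1 + 4 * β / (γ₀ * Λ)) ^ 2 = 1 + 4 * β / (γ₀ * Λ) :=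
        Real.sq_sqrt (by positivity)
      calc φmin ^ 2 + γ₀ * Λ * φmin
          = (γ₀ * Λ) ^ 2 / 4 * (Real.sqrt (1 + 4 * β / (γ₀ * Λ)) ^ 2 - 1) := by
            simp only [φmin]
            ring
        _ = γ₀ * Λ * β := by
            rw [hsq]
            field_simp
            ring
    rw [hΨ]
    exact sq_mul_inv_add_le_of_root β (γ₀ * Λ) φmin φ hβ hg hmin hφ hroot
end

section
/- The optimal reference length satisfies β − β²/(γ₀Λ) ≤ φ_min < β. Consequently, when γ₀Λ ≫ 4β the optimal reference length φ_min is approximately β, i.e., classical DCSK (φ = β) is asymptotically optimal. -/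
/-- The optimal reference length satisfies `β − β²/(γ₀Λ) ≤ φ_min < β`; hence when
`γ₀Λ ≫ 4β` the optimal reference length is approximately `β` (classical DCSK). -/
theorem stmt_4 (β γ₀ Λ : ℝ) (hβ : 0 < β) (hγ : 0 < γ₀) (hΛ : 0 < Λ) :
    let φmin : ℝ := (γ₀ * Λ / 2) * (Real.sqrt (1 + 4 * β / (γ₀ * Λ)) - 1)
    β - β ^ 2 / (γ₀ * Λ) ≤ φmin ∧ φmin < β := by
  intro φmin
  have hs : 0 < γ₀ * Λ := mul_pos hγ hΛ
  have hq : 0 < 4 * β / (γ₀ * Λ) := by positivity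
  have hr : 1 < Real.sqrt (1 + 4 * β / (γ₀ * Λ)) :=
    Real.lt_sqrt_of_sq_lt (by linarith)
  have hsq : Real.sqrt (1 + 4 * β / (γ₀ * Λ)) ^ 2 = 1 + 4 * β / (γ₀ * Λ) :=
    Real.sq_sqrt (by linarith)
  have hφ : 0 < φmin := mul_pos (half_pos hs) (sub_pos.2 hr)
  have hgap : β - φmin = φmin ^ 2 / (γ₀ * Λ) := by
    have hβ_eq : β = γ₀ * Λ * (Real.sqrt (1 + 4 * β / (γ₀ * Λ)) ^ 2 - 1) / 4 := by
      rw [hsq]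
      field_simp
      ring
    rw [eq_div_iff hs.ne']
    linear_combination (γ₀ * Λ) * hβ_eq
  have hlt : φmin < β := sub_pos.1 (hgap ▸ by positivity)
  refine ⟨?_, hlt⟩
  have hle : φmin ^ 2 / (γ₀ * Λ) ≤ β ^ 2 / (γ₀ * Λ) := by gcongr
  linarith
end

section
/- For fixed β > 0, the optimal reference length is strictly increasing in the product γ₀Λ: the function c ↦ (c/2)·(√(1 + 4β/c) − 1) is strictly monotone increasing on (0,∞). -/
/-- Rationalized form of `(c / 2) * (√(1 + 4 * β / c) - 1)`. -/
theorem half_mul_sqrt_sub_one_eq_div {β c : ℝ} (hβ : 0 ≤ β) (hc : 0 < c) :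
    (c / 2) * (Real.sqrt (1 + 4 * β / c) - 1) = 2 * β / (Real.sqrt (1 + 4 * β / c) + 1) := by
  have hsq : Real.sqrt (1 + 4 * β / c) ^ 2 = 1 + 4 * β / c := Real.sq_sqrt (by positivity)
  rw [eq_div_iff (by positivity)]
  calc (c / 2) * (Real.sqrt (1 + 4 * β / c) - 1) * (Real.sqrt (1 + 4 * β / c) + 1)
      = (c / 2) * (Real.sqrt (1 + 4 * β / c) ^ 2 - 1) := by ring
    _ = 2 * β := by rw [hsq]; field_simp; ring

/-- For fixed `β > 0`, the optimal reference length is strictly increasing in the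
product `c = γ₀Λ`: the function `c ↦ (c/2)·(√(1 + 4β/c) − 1)` is strictly monotone
increasing on `(0,∞)`. -/
theorem stmt_5 (β : ℝ) (hβ : 0 < β) :
    StrictMonoOn (fun c : ℝ => (c / 2) * (Real.sqrt (1 + 4 * β / c) - 1))
      (Set.Ioi 0) := by
  intro a ha b hb hab
  rw [Set.mem_Ioi] at ha hb
  have hsqrt : Real.sqrt (1 + 4 * β / b) < Real.sqrt (1 + 4 * β / a) :=
    Real.sqrt_lt_sqrt (by positivity) (by gcongr)
  simp only [half_mul_sqrt_sub_one_eq_div hβ.le ha, half_mul_sqrt_sub_one_eq_div hβ.le hb]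
  gcongr
end
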